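/- Let ζ ∈ α+ℤ (α ∈ C̄) be such that ℓ₀ℓ_r has no roots in Z := {η ∈ α+ℤ : η < ζ}. Then {1, S, …, S^{r−1}} is a local integral basis of A at Z ∪ {ζ}: for every η ∈ Z ∪ {ζ}, each S^{i−1} (i = 1, …, r) is integral at η, and every f ∈ A integral at η lies in C(x)_η·1 + C(x)_η·S + ⋯ + C(x)_η·S^{r−1}. -/

import Mathlib

set_option maxHeartbeats 1000000
set_option synthInstance.maxHeartbeats 200000

open Polynomial Filter

noncomputable section

namespace PRec

variable (C : Type*) [Field C] [CharZero C]

/-- The algebraic closure of the coefficient field. -/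
abbrev Cbar := AlgebraicClosure C

/-- The field of formal Laurent series over the algebraic closure. -/
abbrev LS := LaurentSeries (Cbar C)

/-- The Laurent-series variable `q`. -/
def qv : LS C := HahnSeries.single 1 1

open Classical in
/-- The valuation `ν_q`, with `ν_q 0 = ⊤`, valued in the extended reals. -/
def nuq (a : LS C) : EReal := if a = 0 then ⊤ else (((a.order : ℤ) : ℝ) : EReal)

/-- Evaluation of a rational function at the point `α + m + q`. -/
def evalAt (α : Cbar C) (m : ℤ) (p : RatFunc C) : LS C :=
  RatFunc.eval ((algebraMap (Cbar C) (LS C)).comp (algebraMap C (Cbar C)))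
    (algebraMap (Cbar C) (LS C) α + (m : LS C) + qv C) p

/-- Shorthand for the canonical map `C[x] → C(x)`. -/
abbrev toRat : Polynomial C →+* RatFunc C := algebraMap (Polynomial C) (RatFunc C)

variable (ℓ : ℕ → Polynomial C) (r : ℕ)

/-- The solution space `Sol_α(L)` of `L = ℓ₀ + ℓ₁ S + ⋯ + ℓ_r S^r` at `α`,
indexed so that `b n` stands for the value of the solution at `α + n`. -/
def SolSet (α : Cbar C) : Set (ℤ → LS C) :=
  {b | ∀ n : ℤ, ∑ i ∈ Finset.range (r + 1),
      evalAt C α n (toRat C (ℓ i)) * b (n + i) = 0}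

/-- The action of an element `f = f₀ + f₁ S + ⋯ + f_{r-1} S^{r-1}` of
`A = C(x)[S]/⟨L⟩` (represented by its coefficient vector) on a sequence. -/
def elemApply (α : Cbar C) (f : Fin r → RatFunc C) (b : ℤ → LS C) : ℤ → LS C :=
  fun n => ∑ i : Fin r, evalAt C α n (f i) * b (n + (i : ℤ))

/-- Truncated subtraction on extended reals with the convention `⊤ - ⊤ = ⊤`. -/
def esub (a b : EReal) : EReal := if b = ⊤ then ⊤ else a - b

/-- The value function `val_α` on `A`. -/
def valAt (α : Cbar C) (f : Fin r → RatFunc C) : EReal :=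
  ⨅ b ∈ SolSet C ℓ r α,
    esub (nuq C (elemApply C r α f b 0))
      (Filter.liminf (fun n : ℕ => nuq C (b (-(n : ℤ)))) Filter.atTop)

/-- `f ∈ A` is (locally) integral at `α`. -/
def IntegralAt (α : Cbar C) (f : Fin r → RatFunc C) : Prop :=
  0 ≤ valAt C ℓ r α f

/-- Membership in the local subring `C(x)_α` of rational functions having no pole at `α`. -/
def InLocalRing (α : Cbar C) (f : RatFunc C) : Prop :=
  ∃ p q : Polynomial C, (Polynomial.aeval α) q ≠ 0 ∧ f = toRat C p / toRat C q

/-- `W` is a `C(x)`-vector space basis of `A` (represented on coefficient vectors). -/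
def IsVSBasis (W : Fin r → (Fin r → RatFunc C)) : Prop :=
  LinearIndependent (RatFunc C) W ∧
    Submodule.span (RatFunc C) (Set.range W) = (⊤ : Submodule (RatFunc C) (Fin r → RatFunc C))

/-- The `C(x)_α`-span of a tuple of elements of `A`. -/
def localSpan (α : Cbar C) (W : Fin r → (Fin r → RatFunc C)) :
    Set (Fin r → RatFunc C) :=
  {f | ∃ c : Fin r → RatFunc C, (∀ i, InLocalRing C α (c i)) ∧ f = ∑ i, c i • W i}

/-- `W` is a local integral basis of `A` at `α`. -/
def IsLocalIntegralBasis (α : Cbar C) (W : Fin r → (Fin r → RatFunc C)) : Prop :=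
  IsVSBasis C r W ∧ (∀ i, IntegralAt C ℓ r α (W i)) ∧
    ∀ f : Fin r → RatFunc C, IntegralAt C ℓ r α f → f ∈ localSpan C r α W

/-- The standard basis `1, S, …, S^{r-1}` of `A`. -/
def stdBasis : Fin r → (Fin r → RatFunc C) :=
  fun i j => if j = i then 1 else 0

/-- The shift automorphism `p(x) ↦ p(x+c)` of the polynomial ring. -/
def polyShiftEquiv (c : C) : Polynomial C ≃+* Polynomial C where
  toFun p := p.comp (X + Polynomial.C c)
  invFun p := p.comp (X - Polynomial.C c)
  left_inv p := by
    show (p.comp (X + Polynomial.C c)).comp (X - Polynomial.C c) = p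
    rw [Polynomial.comp_assoc]; simp
  right_inv p := by
    show (p.comp (X - Polynomial.C c)).comp (X + Polynomial.C c) = p
    rw [Polynomial.comp_assoc]; simp
  map_add' p q := by simp [Polynomial.add_comp]
  map_mul' p q := by simp [Polynomial.mul_comp]

/-- The shift `σ^k`, `p(x) ↦ p(x+k)`, on polynomials, for `k : ℤ`. -/
def polyShift (k : ℤ) (p : Polynomial C) : Polynomial C := polyShiftEquiv C (k : C) p

/-- `σ` on polynomials. -/
def polyσ : Polynomial C ≃+* Polynomial C := polyShiftEquiv C 1

/-- The shift automorphism `σ : f(x) ↦ f(x+1)` of the rational function field. -/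
def ratσ : RatFunc C →+* RatFunc C :=
  RatFunc.mapRingHom (polyσ C : Polynomial C →+* Polynomial C)
    (by
      intro p hp
      simp only [Submonoid.mem_comap]
      refine mem_nonZeroDivisors_iff_ne_zero.mpr ?_
      have hp0 : p ≠ 0 := mem_nonZeroDivisors_iff_ne_zero.mp hp
      simpa using (map_ne_zero_iff _ (polyσ C).injective).mpr hp0)

variable [NeZero r]

/-- The index `r - 1` as an element of `Fin r`. -/
def lastIdx : Fin r := ⟨r - 1, Nat.sub_lt (Nat.pos_of_ne_zero (NeZero.ne r)) one_pos⟩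

/-- The action of `S` on `A = C(x)[S]/⟨L⟩`, on coefficient vectors with respect to the
basis `1, S, …, S^{r-1}`, using `S^r = -(ℓ₀/ℓ_r) - ⋯ - (ℓ_{r-1}/ℓ_r) S^{r-1}`. -/
def Smap (f : Fin r → RatFunc C) : Fin r → RatFunc C :=
  fun j =>
    (if (j : ℕ) = 0 then 0 else
      ratσ C (f ⟨(j : ℕ) - 1, lt_of_le_of_lt (Nat.sub_le _ _) j.isLt⟩))
      - ratσ C (f (lastIdx r)) * (toRat C (ℓ j) / toRat C (ℓ r))

/-- The difference operator `Δ = S - 1` on `A`. -/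
def Dmap (f : Fin r → RatFunc C) : Fin r → RatFunc C :=
  Smap C ℓ r f - f

/-- `f ∈ A` is summable. -/
def IsSummable (f : Fin r → RatFunc C) : Prop :=
  ∃ g : Fin r → RatFunc C, f = Dmap C ℓ r g

/-- `disp_α(p) ≥ k`: `p` has two roots in `α + ℤ` at distance `k`. -/
def DispGe (α : Cbar C) (p : Polynomial (Cbar C)) (k : ℕ) : Prop :=
  ∃ m : ℤ, Polynomial.eval (α + (m : Cbar C)) p = 0 ∧
    Polynomial.eval (α + (m : Cbar C) + (k : Cbar C)) p = 0

/-- The dispersion `disp_α(p)` as an extended natural number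
(`0` by convention for the empty set, which is excluded by the hypotheses below). -/
def dispVal (α : Cbar C) (p : Polynomial (Cbar C)) : ℕ∞ :=
  sSup ((fun k : ℕ => (k : ℕ∞)) '' {k : ℕ | DispGe C α p k})

/-- A polynomial is shift-free if it is coprime to each of its nontrivial shifts. -/
def ShiftFree {K : Type*} [Field K] [CharZero K] (p : Polynomial K) : Prop :=
  ∀ k : ℤ, k ≠ 0 → IsCoprime p (p.comp (X + Polynomial.C (k : K)))


/-! ### The `q`-adic valuation -/

section Valuation

omit [CharZero C]

lemma nuq_zero : nuq C 0 = ⊤ := by simp [nuq]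

lemma nuq_of_ne_zero {a : LS C} (ha : a ≠ 0) :
    nuq C a = (((a.order : ℤ) : ℝ) : EReal) := by simp [nuq, ha]

lemma nuq_ne_bot (a : LS C) : nuq C a ≠ ⊥ := by
  unfold nuq
  split_ifs <;> simp

lemma nuq_one : nuq C 1 = 0 := by
  simp [nuq_of_ne_zero]

lemma nuq_mul (a b : LS C) : nuq C (a * b) = nuq C a + nuq C b := by
  by_cases ha : a = 0
  · simp [ha, nuq_zero, EReal.top_add_of_ne_bot (nuq_ne_bot C b)]
  by_cases hb : b = 0
  · simp [hb, nuq_zero, EReal.add_top_of_ne_bot (nuq_ne_bot C a)]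
  rw [nuq_of_ne_zero C ha, nuq_of_ne_zero C hb, nuq_of_ne_zero C (mul_ne_zero ha hb),
    HahnSeries.order_mul ha hb]
  push_cast
  rfl

lemma nuq_neg (a : LS C) : nuq C (-a) = nuq C a := by
  have h : (-a).order = a.order := HahnSeries.order_neg
  by_cases ha : a = 0
  · rw [ha, neg_zero]
  · rw [nuq_of_ne_zero C ha, nuq_of_ne_zero C (neg_ne_zero.mpr ha), h]

lemma le_nuq_add {c : EReal} {a b : LS C} (ha : c ≤ nuq C a) (hb : c ≤ nuq C b) :
    c ≤ nuq C (a + b) := by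
  by_cases ha0 : a = 0
  · simpa [ha0] using hb
  by_cases hb0 : b = 0
  · simpa [hb0] using ha
  by_cases hab : a + b = 0
  · simp [hab, nuq_zero]
  rw [nuq_of_ne_zero C ha0] at ha
  rw [nuq_of_ne_zero C hb0] at hb
  rw [nuq_of_ne_zero C hab]
  rcases min_le_iff.mp (HahnSeries.min_order_le_order_add hab) with h | h
  · exact ha.trans (by exact_mod_cast h)
  · exact hb.trans (by exact_mod_cast h)

lemma le_nuq_sum {ι : Type*} {c : EReal} (s : Finset ι) (a : ι → LS C)
    (h : ∀ i ∈ s, c ≤ nuq C (a i)) : c ≤ nuq C (∑ i ∈ s, a i) := by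
  classical
  induction s using Finset.induction_on with
  | empty => simp [nuq_zero]
  | insert i s hi ih =>
    rw [Finset.sum_insert hi]
    exact le_nuq_add C (h i (Finset.mem_insert_self i s))
      (ih fun j hj => h j (Finset.mem_insert_of_mem hj))

lemma le_nuq_mul {c : EReal} {u a : LS C} (hu : 0 ≤ nuq C u) (ha : c ≤ nuq C a) :
    c ≤ nuq C (u * a) := by
  rw [nuq_mul]
  simpa using add_le_add hu ha

/-- In a vanishing linear combination with coefficients of nonnegative valuation, a term whose
coefficient has valuation zero inherits every lower bound on the valuations of the others. -/
lemma le_nuq_of_sum_eq_zero {ι : Type*} {c : EReal} (s : Finset ι) (e a : ι → LS C)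
    (hsum : ∑ i ∈ s, e i * a i = 0) {j : ι} (hj : j ∈ s) (hej : nuq C (e j) = 0)
    (he : ∀ i ∈ s, 0 ≤ nuq C (e i)) (ha : ∀ i ∈ s, i ≠ j → c ≤ nuq C (a i)) :
    c ≤ nuq C (a j) := by
  classical
  rw [← Finset.add_sum_erase s _ hj] at hsum
  have h1 : nuq C (a j) = nuq C (e j * a j) := by rw [nuq_mul, hej, zero_add]
  rw [h1, eq_neg_of_add_eq_zero_left hsum, nuq_neg]
  refine le_nuq_sum C _ _ fun i hi => ?_
  have hi' := Finset.mem_erase.mp hi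
  exact le_nuq_mul C (he i hi'.2) (ha i hi'.2 hi'.1)

lemma nuq_ofPowerSeries_nonneg (f : PowerSeries (Cbar C)) :
    0 ≤ nuq C (HahnSeries.ofPowerSeries ℤ (Cbar C) f) := by
  by_cases h : HahnSeries.ofPowerSeries ℤ (Cbar C) f = 0
  · simp [h, nuq_zero]
  rw [nuq_of_ne_zero C h]
  by_contra hlt
  have hneg : (HahnSeries.ofPowerSeries ℤ (Cbar C) f).order < 0 := by
    have := not_le.mp hlt
    exact_mod_cast this
  apply h
  rw [← HahnSeries.coeff_order_eq_zero]
  generalize (HahnSeries.ofPowerSeries ℤ (Cbar C) f).order = k at hneg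
  rw [HahnSeries.ofPowerSeries_apply]
  refine HahnSeries.embDomain_of_notMem_range ?_
  rintro ⟨n, hn⟩
  have hn' : (n : ℤ) = k := hn
  omega

lemma nuq_ofPowerSeries_eq_zero {f : PowerSeries (Cbar C)}
    (hf : PowerSeries.constantCoeff f ≠ 0) :
    nuq C (HahnSeries.ofPowerSeries ℤ (Cbar C) f) = 0 := by
  refine le_antisymm ?_ (nuq_ofPowerSeries_nonneg C f)
  have hc : (HahnSeries.ofPowerSeries ℤ (Cbar C) f).coeff ((0 : ℕ) : ℤ) ≠ 0 := by
    rw [HahnSeries.ofPowerSeries_apply_coeff]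
    simpa using hf
  have h : HahnSeries.ofPowerSeries ℤ (Cbar C) f ≠ 0 := fun h => hc (by rw [h]; rfl)
  rw [nuq_of_ne_zero C h]
  have := HahnSeries.order_le_of_coeff_ne_zero hc
  exact_mod_cast this

lemma one_le_nuq_ofPowerSeries {f : PowerSeries (Cbar C)}
    (hf : PowerSeries.constantCoeff f = 0) :
    1 ≤ nuq C (HahnSeries.ofPowerSeries ℤ (Cbar C) f) := by
  obtain ⟨g, rfl⟩ := PowerSeries.X_dvd_iff.mpr hf
  rw [map_mul, mul_comm]
  refine le_nuq_mul C (nuq_ofPowerSeries_nonneg C g) ?_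
  rw [HahnSeries.ofPowerSeries_X,
    nuq_of_ne_zero C (HahnSeries.single_ne_zero one_ne_zero),
    HahnSeries.order_single one_ne_zero]
  simp

end Valuation

/-! ### Evaluation of polynomials at `α + m + q` -/

section Evaluation

omit [CharZero C]

/-- The power series expansion of the polynomial `p` around `β`. -/
def expand (β : Cbar C) (p : Polynomial C) : PowerSeries (Cbar C) :=
  (((p.map (algebraMap C (Cbar C))).comp (X + Polynomial.C β) : Polynomial (Cbar C)) :
    PowerSeries (Cbar C))

lemma constantCoeff_expand (β : Cbar C) (p : Polynomial C) :
    PowerSeries.constantCoeff (expand C β p) = aeval β p := by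
  rw [expand, Polynomial.constantCoeff_coe, Polynomial.coeff_zero_eq_eval_zero]
  simp [Polynomial.eval_map_algebraMap]

lemma expand_ne_zero (β : Cbar C) {p : Polynomial C} (hp : p ≠ 0) : expand C β p ≠ 0 := by
  rw [expand, Ne, Polynomial.coe_eq_zero_iff, Polynomial.comp_X_add_C_eq_zero_iff]
  simpa [Polynomial.map_eq_zero] using hp

lemma eval₂_eq_expand (α : Cbar C) (m : ℤ) (p : Polynomial C) :
    p.eval₂ ((algebraMap (Cbar C) (LS C)).comp (algebraMap C (Cbar C)))
      (algebraMap (Cbar C) (LS C) α + (m : LS C) + qv C) =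
    HahnSeries.ofPowerSeries ℤ (Cbar C) (expand C (α + (m : Cbar C)) p) := by
  let Φ : Polynomial (Cbar C) →+* LS C :=
    (HahnSeries.ofPowerSeries ℤ (Cbar C)).comp Polynomial.coeToPowerSeries.ringHom
  have hC : ∀ c : Cbar C, Φ (Polynomial.C c) = algebraMap (Cbar C) (LS C) c := fun c => by
    simp [Φ, HahnSeries.algebraMap_apply']
  have hX : Φ X = qv C := by
    simp [Φ, qv]
  change _ = Φ ((p.map (algebraMap C (Cbar C))).comp (X + Polynomial.C (α + (m : Cbar C))))
  rw [Polynomial.comp, Polynomial.hom_eval₂, Polynomial.eval₂_map, map_add, hC, hX, map_add,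
    map_intCast, add_comm (qv C)]
  congr 1
  ext c
  simp only [RingHom.comp_apply, hC]

lemma evalAt_toRat (α : Cbar C) (m : ℤ) (p : Polynomial C) :
    evalAt C α m (toRat C p) =
      HahnSeries.ofPowerSeries ℤ (Cbar C) (expand C (α + (m : Cbar C)) p) := by
  rw [evalAt, RatFunc.eval_algebraMap, Algebra.algebraMap_self_apply, eval₂_eq_expand]

lemma evalAt_toRat_ne_zero (α : Cbar C) (m : ℤ) {p : Polynomial C} (hp : p ≠ 0) :
    evalAt C α m (toRat C p) ≠ 0 := by
  rw [evalAt_toRat, Ne, map_eq_zero_iff _ HahnSeries.ofPowerSeries_injective]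
  exact expand_ne_zero C _ hp

lemma nuq_evalAt_toRat_nonneg (α : Cbar C) (m : ℤ) (p : Polynomial C) :
    0 ≤ nuq C (evalAt C α m (toRat C p)) := by
  rw [evalAt_toRat]
  exact nuq_ofPowerSeries_nonneg C _

lemma nuq_evalAt_toRat_eq_zero (α : Cbar C) (m : ℤ) {p : Polynomial C}
    (hp : aeval (α + (m : Cbar C)) p ≠ 0) : nuq C (evalAt C α m (toRat C p)) = 0 := by
  rw [evalAt_toRat]
  exact nuq_ofPowerSeries_eq_zero C (by rwa [constantCoeff_expand])

lemma evalAt_mul_denom (α : Cbar C) (m : ℤ) (f : RatFunc C) :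
    evalAt C α m f * evalAt C α m (toRat C f.denom) = evalAt C α m (toRat C f.num) := by
  have h := evalAt_toRat_ne_zero C α m f.denom_ne_zero
  rw [evalAt_toRat, ← eval₂_eq_expand] at h ⊢
  rw [evalAt_toRat, ← eval₂_eq_expand, evalAt, RatFunc.eval, div_mul_cancel₀ _ h]

/-- A rational function whose value at `α + q` has nonnegative valuation has no pole at `α`. -/
lemma inLocalRing_of_nuq_nonneg (α : Cbar C) (f : RatFunc C)
    (hf : 0 ≤ nuq C (evalAt C α 0 f)) : InLocalRing C α f := by
  refine ⟨f.num, f.denom, fun hd => ?_, (RatFunc.num_div_denom f).symm⟩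
  obtain ⟨u, v, huv⟩ := RatFunc.isCoprime_num_denom f
  have hn : aeval (α + ((0 : ℤ) : Cbar C)) f.num ≠ 0 := by
    intro hn
    have h := congrArg (aeval α) huv
    simp only [Int.cast_zero, add_zero] at hn
    simp [hd, hn] at h
  have h1 : 1 ≤ nuq C (evalAt C α 0 (toRat C f.denom)) := by
    rw [evalAt_toRat]
    exact one_le_nuq_ofPowerSeries C (by simpa [constantCoeff_expand] using hd)
  have h2 := le_nuq_mul C hf h1
  rw [evalAt_mul_denom, nuq_evalAt_toRat_eq_zero C α 0 hn] at h2
  exact absurd h2 (by norm_num)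

end Evaluation

/-! ### Solutions of linear recurrences with prescribed initial values -/

section Existence

variable {K : Type*} [Field K]

/-- The solution on `ℕ` of a recurrence of order `d` with given initial values. -/
def forwardSol (d : ℕ) (e : ℕ → ℕ → K) (init : ℕ → K) (n : ℕ) : K :=
  if _h : n < d then init n
  else -(∑ i : Fin d, e i (n - d) * forwardSol d e init (n - d + i)) / e d (n - d)
termination_by n
decreasing_by have := i.isLt; omega

lemma exists_forward_solution (d : ℕ) (e : ℕ → ℕ → K) (he : ∀ n, e d n ≠ 0) (init : ℕ → K) :
    ∃ b : ℕ → K, (∀ i < d, b i = init i) ∧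
      ∀ n, ∑ i ∈ Finset.range (d + 1), e i n * b (n + i) = 0 := by
  refine ⟨forwardSol d e init, fun i hi => by rw [forwardSol, dif_pos hi], fun n => ?_⟩
  rw [Finset.sum_range_succ, Finset.sum_range]
  conv_lhs => enter [2, 2]; rw [forwardSol]
  rw [dif_neg (by omega), Nat.add_sub_cancel, mul_div_cancel₀ _ (he n), add_neg_cancel]

lemma exists_solution (d : ℕ) (e : ℕ → ℤ → K) (h0 : ∀ n, e 0 n ≠ 0) (hd : ∀ n, e d n ≠ 0)
    (init : ℕ → K) :
    ∃ b : ℤ → K, (∀ i < d, b (i : ℤ) = init i) ∧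
      ∀ n, ∑ i ∈ Finset.range (d + 1), e i n * b (n + i) = 0 := by
  obtain ⟨f, hf0, hf⟩ := exists_forward_solution d (fun i n => e i n) (fun n => hd n) init
  obtain ⟨g, hg0, hg⟩ := exists_forward_solution d (fun i n => e (d - i) (-1 - n))
    (fun n => by simpa using h0 _) (fun i => init (d - 1 - i))
  let b : ℤ → K := fun z => if 0 ≤ z then f z.toNat else g (d - 1 - z).toNat
  have hbf : ∀ z : ℤ, 0 ≤ z → b z = f z.toNat := fun z hz => if_pos hz
  have hbg : ∀ z : ℤ, z < d → b z = g (d - 1 - z).toNat := fun z hz => by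
    by_cases h : 0 ≤ z
    · rw [hbf z h, hf0 _ (by omega), hg0 _ (by omega)]
      congr 1
      omega
    · exact if_neg h
  refine ⟨b, fun i hi => by rw [hbf _ (by omega), Int.toNat_natCast, hf0 i hi], fun n => ?_⟩
  by_cases hn : 0 ≤ n
  · rw [← hf n.toNat]
    refine Finset.sum_congr rfl fun i _ => ?_
    rw [hbf _ (by omega), Int.toNat_of_nonneg hn]
    congr 2
    omega
  · rw [← hg (-1 - n).toNat, ← Finset.sum_range_reflect]
    refine Finset.sum_congr rfl fun i hi => ?_
    have hi' := Finset.mem_range.mp hi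
    rw [hbg _ (by omega), Int.toNat_of_nonneg (by omega)]
    congr 2
    · omega
    · omega

end Existence

/-! ### Integrality of the standard basis -/

section Integrality

omit [CharZero C]

variable {C} {d : ℕ} {α : Cbar C}

variable (C) in
lemma sum_smul_stdBasis (f : Fin d → RatFunc C) : ∑ i, f i • stdBasis C d i = f := by
  ext j
  simp [stdBasis, Finset.sum_apply]

variable (C) in
lemma isVSBasis_stdBasis : IsVSBasis C d (stdBasis C d) := by
  constructor
  · rw [Fintype.linearIndependent_iff]
    intro g hg i
    rw [sum_smul_stdBasis] at hg
    exact congrFun hg i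
  · rw [eq_top_iff]
    intro f _
    rw [← sum_smul_stdBasis C f]
    exact Submodule.sum_mem _ fun i _ =>
      Submodule.smul_mem _ _ (Submodule.subset_span ⟨i, rfl⟩)

lemma elemApply_stdBasis (i : Fin d) (b : ℤ → LS C) :
    elemApply C d α (stdBasis C d i) b 0 = b i := by
  rw [elemApply, Finset.sum_eq_single i]
  · simp [stdBasis, evalAt]
  · intro j _ hj
    simp [stdBasis, evalAt, hj]
  · simp

/-- If `ℓ_d` has no roots strictly to the left of `α`, then the values of a solution at
`α, …, α + d - 1` have valuation at least that of the solution near `α - ∞`. -/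
lemma liminf_le_nuq (hd : ∀ n : ℤ, n < 0 → aeval (α + (n : Cbar C)) (ℓ d) ≠ 0)
    {b : ℤ → LS C} (hb : b ∈ SolSet C ℓ d α) (i : Fin d) :
    liminf (fun n : ℕ => nuq C (b (-(n : ℤ)))) atTop ≤ nuq C (b i) := by
  refine le_of_forall_lt_imp_le_of_dense fun c hc => ?_
  obtain ⟨N, hN⟩ := eventually_atTop.mp (eventually_lt_of_lt_liminf hc)
  have key : ∀ k : ℕ, (k : ℤ) < N + 2 * d → c ≤ nuq C (b (-((N : ℤ) + d) + k)) := by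
    intro k
    induction k using Nat.strong_induction_on with
    | _ k ih =>
      intro hk
      by_cases hkd : k < d
      · have h := hN (N + d - k) (by omega)
        have hcast : -((N + d - k : ℕ) : ℤ) = -((N : ℤ) + d) + k := by omega
        rw [hcast] at h
        exact h.le
      have hrec := hb (-((N : ℤ) + d) + k - d)
      have h := le_nuq_of_sum_eq_zero (c := c) C _ _ _ hrec
        (Finset.mem_range.mpr (Nat.lt_succ_self d))
        (nuq_evalAt_toRat_eq_zero C α _ (hd _ (by omega)))
        (fun j _ => nuq_evalAt_toRat_nonneg C α _ _) (fun j hj hjd => ?_)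
      · simpa using h
      · have hj' := Finset.mem_range.mp hj
        have h := ih (k - d + j) (by omega) (by omega)
        convert h using 3
        omega
  have h := key (N + d + i) (by have := i.isLt; omega)
  convert h using 3
  push_cast
  ring

lemma integralAt_stdBasis (hd : ∀ n : ℤ, n < 0 → aeval (α + (n : Cbar C)) (ℓ d) ≠ 0)
    (i : Fin d) : IntegralAt C ℓ d α (stdBasis C d i) := by
  refine le_iInf₂ fun b hb => ?_
  rw [elemApply_stdBasis, esub]
  split_ifs with h
  · exact le_top
  · rw [EReal.sub_nonneg (Or.inr h) (Or.inl (nuq_ne_bot C _))]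
    exact liminf_le_nuq ℓ hd hb i

/-- If `ℓ₀` has no roots strictly to the left of `α`, then nonnegativity of the valuation of a
solution propagates to the left. -/
lemma nuq_nonneg_of_initial (h0 : ∀ n : ℤ, n < 0 → aeval (α + (n : Cbar C)) (ℓ 0) ≠ 0)
    {b : ℤ → LS C} (hb : b ∈ SolSet C ℓ d α) (hinit : ∀ i < d, 0 ≤ nuq C (b (i : ℤ))) (k : ℕ) :
    0 ≤ nuq C (b ((d : ℤ) - 1 - k)) := by
  induction k using Nat.strong_induction_on with
  | _ k ih =>
    by_cases hkd : k < d
    · have h := hinit (d - 1 - k) (by omega)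
      convert h using 3
      omega
    have hrec := hb ((d : ℤ) - 1 - k)
    have h := le_nuq_of_sum_eq_zero (c := 0) C _ _ _ hrec
      (Finset.mem_range.mpr (Nat.succ_pos d))
      (nuq_evalAt_toRat_eq_zero C α _ (h0 _ (by omega)))
      (fun j _ => nuq_evalAt_toRat_nonneg C α _ _) (fun j hj hj0 => ?_)
    · simpa using h
    · have hj' := Finset.mem_range.mp hj
      have h := ih (k - j) (by omega)
      convert h using 3
      omega

lemma inLocalRing_of_integralAt (h0 : ℓ 0 ≠ 0) (hd : ℓ d ≠ 0)
    (hne : ∀ n : ℤ, n < 0 → aeval (α + (n : Cbar C)) (ℓ 0) ≠ 0 ∧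
      aeval (α + (n : Cbar C)) (ℓ d) ≠ 0)
    {f : Fin d → RatFunc C} (hf : IntegralAt C ℓ d α f) (i : Fin d) :
    InLocalRing C α (f i) := by
  obtain ⟨b, hinit, hrec⟩ := exists_solution d (fun j n => evalAt C α n (toRat C (ℓ j)))
    (fun n => evalAt_toRat_ne_zero C α n h0) (fun n => evalAt_toRat_ne_zero C α n hd)
    (fun j => if j = i then 1 else 0)
  have hb : b ∈ SolSet C ℓ d α := hrec
  have hbi : b i = 1 := by rw [hinit _ i.isLt, if_pos rfl]
  have happly : elemApply C d α f b 0 = evalAt C α 0 (f i) := by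
    rw [elemApply, Finset.sum_eq_single i]
    · rw [zero_add, hbi, mul_one]
    · intro j _ hj
      rw [zero_add, hinit _ j.isLt, if_neg (fun h => hj (Fin.ext h)), mul_zero]
    · simp
  have hpos : ∀ k : ℕ, 0 ≤ nuq C (b ((d : ℤ) - 1 - k)) :=
    nuq_nonneg_of_initial ℓ (fun n hn => (hne n hn).1) hb fun j hj => by
      rw [hinit j hj]
      split_ifs
      · rw [nuq_one]
      · simp [nuq_zero]
  have hlim0 : 0 ≤ liminf (fun n : ℕ => nuq C (b (-(n : ℤ)))) atTop := by
    refine le_liminf_of_le (h := Eventually.of_forall fun n => ?_)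
    have h := hpos (n + d - 1)
    convert h using 3
    have := i.isLt
    omega
  have hlim1 := liminf_le_nuq ℓ (fun n hn => (hne n hn).2) hb i
  rw [hbi, nuq_one] at hlim1
  have hval := hf.trans (iInf₂_le b hb)
  rw [happly, le_antisymm hlim1 hlim0, esub, if_neg EReal.zero_ne_top, sub_zero] at hval
  exact inLocalRing_of_nuq_nonneg C α (f i) hval

end Integrality

theorem statement4 (hr : 1 ≤ r) (hℓ : ℓ 0 * ℓ r ≠ 0) (α : Cbar C) (z₀ : ℤ)
    (hroots : ∀ m : ℤ, m < z₀ → (Polynomial.aeval (α + (m : Cbar C))) (ℓ 0 * ℓ r) ≠ 0) :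
    ∀ m : ℤ, m ≤ z₀ → IsLocalIntegralBasis C ℓ r (α + (m : Cbar C)) (stdBasis C r) := by
  intro m hm
  have hne : ∀ n : ℤ, n < 0 →
      aeval (α + (m : Cbar C) + (n : Cbar C)) (ℓ 0) ≠ 0 ∧
      aeval (α + (m : Cbar C) + (n : Cbar C)) (ℓ r) ≠ 0 := by
    intro n hn
    have h := hroots (m + n) (by omega)
    rw [map_mul] at h
    push_cast at h
    rw [← add_assoc] at h
    exact ⟨left_ne_zero_of_mul h, right_ne_zero_of_mul h⟩
  refine ⟨isVSBasis_stdBasis C, fun i => ?_, fun f hf => ⟨f, fun i => ?_, ?_⟩⟩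
  · exact integralAt_stdBasis ℓ (fun n hn => (hne n hn).2) i
  · exact inLocalRing_of_integralAt ℓ (left_ne_zero_of_mul hℓ) (right_ne_zero_of_mul hℓ)
      hne hf i
  · exact (sum_smul_stdBasis C f).symm

end PRec
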